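/- Let n ≥ 1, 0 < λ ≤ Λ, let X, Y, Z be n×n real symmetric matrices, and let c ≥ 0. Suppose that for all ξ, η ∈ ℝⁿ one has ⟨Xξ, ξ⟩ − ⟨Yη, η⟩ ≤ ⟨Z(ξ−η), ξ−η⟩ + c(|ξ|² + |η|²). Then: (i) every eigenvalue of X − Y is at most 2c; (ii) for every unit vector η̂ ∈ ℝⁿ, ⟨(X−Y)η̂, η̂⟩ ≤ 4⟨Zη̂, η̂⟩ + 2c; and (iii) if there exists a unit vector η̂ with 4⟨Zη̂, η̂⟩ + 2c ≤ 0, then M⁺(X − Y) ≤ 2Λ(n−1)c + λ(4⟨Zη̂, η̂⟩ + 2c), where M⁺ is the Pucci maximal operator with constants λ, Λ. -/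

import Mathlib

open Metric Set Matrix MeasureTheory
open scoped RealInnerProductSpace

noncomputable section

abbrev Euc (n : ℕ) := EuclideanSpace ℝ (Fin n)

def EllMat (n : ℕ) (lam Lam : ℝ) : Set (Matrix (Fin n) (Fin n) ℝ) :=
  {A | A.IsSymm ∧ ∀ ξ : Fin n → ℝ,
      lam * (ξ ⬝ᵥ ξ) ≤ ξ ⬝ᵥ A.mulVec ξ ∧ ξ ⬝ᵥ A.mulVec ξ ≤ Lam * (ξ ⬝ᵥ ξ)}

/-- Pucci maximal operator `M⁺`. -/
def pucciSup (n : ℕ) (lam Lam : ℝ) (M : Matrix (Fin n) (Fin n) ℝ) : ℝ :=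
  sSup ((fun A => (A * M).trace) '' EllMat n lam Lam)

/-- Pucci minimal operator `M⁻`. -/
def pucciInf (n : ℕ) (lam Lam : ℝ) (M : Matrix (Fin n) (Fin n) ℝ) : ℝ :=
  sInf ((fun A => (A * M).trace) '' EllMat n lam Lam)

/-- `(λ,Λ)`-ellipticity of `F`. -/
def IsUniformlyElliptic (n : ℕ) (lam Lam : ℝ)
    (F : Matrix (Fin n) (Fin n) ℝ → ℝ) : Prop :=
  ∀ M N : Matrix (Fin n) (Fin n) ℝ, M.IsSymm → N.IsSymm →
    pucciInf n lam Lam (M - N) ≤ F M - F N ∧ F M - F N ≤ pucciSup n lam Lam (M - N)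

/-- Hessian matrix of `φ` at `x`. -/
def hess {n : ℕ} (φ : Euc n → ℝ) (x : Euc n) : Matrix (Fin n) (Fin n) ℝ :=
  fun i j => iteratedFDeriv ℝ 2 φ x ![EuclideanSpace.single i 1, EuclideanSpace.single j 1]

/-- `κ`-grad viscosity subsolution of `G(Du, D²u) = f` in `s`. -/
def GradSubSol {n : ℕ} (κ : ℝ) (G : Euc n → Matrix (Fin n) (Fin n) ℝ → ℝ)
    (f : Euc n → ℝ) (s : Set (Euc n)) (u : Euc n → ℝ) : Prop :=
  ∀ x₀ ∈ s, ∀ φ : Euc n → ℝ, ContDiff ℝ 2 φ →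
    IsLocalMax (fun x => u x - φ x) x₀ → κ < ‖gradient φ x₀‖ →
    f x₀ ≤ G (gradient φ x₀) (hess φ x₀)

/-- `κ`-grad viscosity supersolution of `G(Du, D²u) = f` in `s`. -/
def GradSupSol {n : ℕ} (κ : ℝ) (G : Euc n → Matrix (Fin n) (Fin n) ℝ → ℝ)
    (f : Euc n → ℝ) (s : Set (Euc n)) (u : Euc n → ℝ) : Prop :=
  ∀ x₀ ∈ s, ∀ φ : Euc n → ℝ, ContDiff ℝ 2 φ →
    IsLocalMin (fun x => u x - φ x) x₀ → κ < ‖gradient φ x₀‖ →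
    G (gradient φ x₀) (hess φ x₀) ≤ f x₀

/-- `κ`-grad viscosity solution. -/
def GradSol {n : ℕ} (κ : ℝ) (G : Euc n → Matrix (Fin n) (Fin n) ℝ → ℝ)
    (f : Euc n → ℝ) (s : Set (Euc n)) (u : Euc n → ℝ) : Prop :=
  GradSubSol κ G f s u ∧ GradSupSol κ G f s u

/-- Classical viscosity solution (no restriction on the slope of test functions). -/
def ViscSol {n : ℕ} (G : Euc n → Matrix (Fin n) (Fin n) ℝ → ℝ)
    (f : Euc n → ℝ) (s : Set (Euc n)) (u : Euc n → ℝ) : Prop :=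
  (∀ x₀ ∈ s, ∀ φ : Euc n → ℝ, ContDiff ℝ 2 φ →
    IsLocalMax (fun x => u x - φ x) x₀ → f x₀ ≤ G (gradient φ x₀) (hess φ x₀)) ∧
  (∀ x₀ ∈ s, ∀ φ : Euc n → ℝ, ContDiff ℝ 2 φ →
    IsLocalMin (fun x => u x - φ x) x₀ → G (gradient φ x₀) (hess φ x₀) ≤ f x₀)

/-- The operator `G(ξ, M) = (|ξ|-κ)₊^q F(M)`. -/
def mainG {n : ℕ} (κ q : ℝ) (F : Matrix (Fin n) (Fin n) ℝ → ℝ) :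
    Euc n → Matrix (Fin n) (Fin n) ℝ → ℝ :=
  fun ξ M => max (‖ξ‖ - κ) 0 ^ q * F M

/-- The set `Ω_u` of points of `s` that can be touched from above or below by a `C²`
function with slope larger than `κ`. -/
def omegaSet {n : ℕ} (κ : ℝ) (s : Set (Euc n)) (u : Euc n → ℝ) : Set (Euc n) :=
  {x ∈ s | ∃ φ : Euc n → ℝ, ContDiff ℝ 2 φ ∧
    (IsLocalMax (fun y => u y - φ y) x ∨ IsLocalMin (fun y => u y - φ y) x) ∧
    κ < ‖gradient φ x‖}

/-- Effective viscosity solution of `(|Du|-κ)₊^q F(D²u) = f` in `s`. -/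
def EffectiveSol {n : ℕ} (κ q : ℝ) (F : Matrix (Fin n) (Fin n) ℝ → ℝ)
    (f : Euc n → ℝ) (s : Set (Euc n)) (u : Euc n → ℝ) : Prop :=
  IsOpen (omegaSet κ s u) ∧ ViscSol (mainG κ q F) f (omegaSet κ s u) u

/-- Spectral theorem for real symmetric matrices in terms of an orthogonal matrix. -/
theorem Matrix.IsHermitian.exists_orthogonal_diagonalization {ι : Type*} [Fintype ι]
    [DecidableEq ι] {M : Matrix ι ι ℝ} (hM : M.IsHermitian) :
    ∃ U : Matrix ι ι ℝ, Uᵀ * U = 1 ∧ U * Uᵀ = 1 ∧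
      M = U * diagonal hM.eigenvalues * Uᵀ := by
  have hstar : star (hM.eigenvectorUnitary : Matrix ι ι ℝ) =
      (hM.eigenvectorUnitary : Matrix ι ι ℝ)ᵀ := by
    rw [star_eq_conjTranspose, conjTranspose_eq_transpose_of_trivial]
  refine ⟨hM.eigenvectorUnitary, ?_, ?_, ?_⟩
  · rw [← hstar]
    exact Unitary.coe_star_mul_self _
  · rw [← hstar]
    exact Unitary.coe_mul_star_self _
  · conv_lhs => rw [hM.spectral_theorem]
    rw [Unitary.conjStarAlgAut_apply, hstar]
    rfl

theorem Matrix.transpose_mul_mul_apply_self {ι : Type*} [Fintype ι]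
    (U A : Matrix ι ι ℝ) (i : ι) :
    (Uᵀ * A * U) i i = U.col i ⬝ᵥ A *ᵥ U.col i := by
  rw [dotProduct_mulVec, Matrix.mul_apply, dotProduct]
  rfl

theorem Matrix.dotProduct_col_self_of_transpose_mul_self {ι : Type*} [Fintype ι]
    [DecidableEq ι] {U : Matrix ι ι ℝ} (hU : Uᵀ * U = 1) (i : ι) :
    U.col i ⬝ᵥ U.col i = 1 := by
  have h := transpose_mul_mul_apply_self U 1 i
  rwa [Matrix.mul_one, hU, one_apply_eq, one_mulVec, eq_comm] at h

/-- The least eigenvalue is bounded by the value of the quadratic form at any unit vector. -/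
theorem Matrix.IsHermitian.exists_eigenvalues_le {ι : Type*} [Fintype ι] [DecidableEq ι]
    {M : Matrix ι ι ℝ} (hM : M.IsHermitian) {η : ι → ℝ} (hη : η ⬝ᵥ η = 1) :
    ∃ k, hM.eigenvalues k ≤ η ⬝ᵥ M *ᵥ η := by
  obtain ⟨U, -, hU, hMU⟩ := hM.exists_orthogonal_diagonalization
  set e := hM.eigenvalues
  have hquad : ∀ D : Matrix ι ι ℝ,
      η ⬝ᵥ (U * D * Uᵀ) *ᵥ η = (Uᵀ *ᵥ η) ⬝ᵥ D *ᵥ (Uᵀ *ᵥ η) := fun D => by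
    rw [← mulVec_mulVec, ← mulVec_mulVec, dotProduct_mulVec, mulVec_transpose]
  have hsum : ∑ i, (Uᵀ *ᵥ η) i ^ 2 = 1 := by
    have h := hquad 1
    rw [Matrix.mul_one, hU, one_mulVec, one_mulVec, hη] at h
    simp only [h, dotProduct, sq]
  have hform : η ⬝ᵥ M *ᵥ η = ∑ i, e i * (Uᵀ *ᵥ η) i ^ 2 := by
    rw [hMU, hquad, dotProduct]
    exact Finset.sum_congr rfl fun i _ => by rw [mulVec_diagonal]; ring
  by_contra! hlt
  have hle : ∀ i ∈ Finset.univ,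
      (η ⬝ᵥ M *ᵥ η) * (Uᵀ *ᵥ η) i ^ 2 ≤ e i * (Uᵀ *ᵥ η) i ^ 2 :=
    fun i _ => mul_le_mul_of_nonneg_right (hlt i).le (sq_nonneg _)
  have heq : ∑ i, (η ⬝ᵥ M *ᵥ η) * (Uᵀ *ᵥ η) i ^ 2 = ∑ i, e i * (Uᵀ *ᵥ η) i ^ 2 := by
    rw [← Finset.mul_sum, hsum, mul_one, hform]
  have hzero : ∀ i, (Uᵀ *ᵥ η) i ^ 2 = 0 := fun i => by
    have h := (Finset.sum_eq_sum_iff_of_le hle).1 heq i (Finset.mem_univ i)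
    by_contra hne
    exact (hlt i).ne (mul_right_cancel₀ hne h)
  simp [hzero] at hsum

theorem EllMat_nonempty {n : ℕ} {lam Lam : ℝ} (h : lam ≤ Lam) : (EllMat n lam Lam).Nonempty := by
  refine ⟨lam • 1, isSymm_one.smul lam, fun ξ => ?_⟩
  rw [smul_mulVec, one_mulVec, dotProduct_smul, smul_eq_mul]
  exact ⟨le_rfl, mul_le_mul_of_nonneg_right h (dotProduct_self_star_nonneg ξ)⟩

/-- The Pucci maximal operator is bounded when all eigenvalues are at most `b` and one of them
is at most `t ≤ 0`. -/
theorem pucciSup_le_of_eigenvalues_le {n : ℕ} {lam Lam : ℝ} (hlam : 0 < lam)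
    (hlamLam : lam ≤ Lam) {M : Matrix (Fin n) (Fin n) ℝ} (hM : M.IsHermitian) {b t : ℝ}
    (hb : 0 ≤ b) (ht : t ≤ 0) (hle : ∀ i, hM.eigenvalues i ≤ b) {k : Fin n}
    (hk : hM.eigenvalues k ≤ t) :
    pucciSup n lam Lam M ≤ ((n : ℝ) - 1) * (Lam * b) + lam * t := by
  obtain ⟨U, hU, -, hMU⟩ := hM.exists_orthogonal_diagonalization
  set e := hM.eigenvalues
  refine csSup_le ((EllMat_nonempty hlamLam).image _) ?_
  rintro _ ⟨A, ⟨-, hA⟩, rfl⟩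
  have htrace : (A * M).trace = ∑ i, (U.col i ⬝ᵥ A *ᵥ U.col i) * e i := by
    rw [hMU, ← Matrix.mul_assoc, trace_mul_comm, ← Matrix.mul_assoc, ← Matrix.mul_assoc, trace]
    exact Finset.sum_congr rfl fun i _ => by
      rw [diag_apply, mul_diagonal, transpose_mul_mul_apply_self]
  have hdiag : ∀ i, lam ≤ U.col i ⬝ᵥ A *ᵥ U.col i ∧ U.col i ⬝ᵥ A *ᵥ U.col i ≤ Lam := fun i => by
    have h := hA (U.col i)
    rwa [dotProduct_col_self_of_transpose_mul_self hU, mul_one, mul_one] at h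
  have hrest : ∑ i ∈ Finset.univ.erase k, (U.col i ⬝ᵥ A *ᵥ U.col i) * e i ≤
      ((n : ℝ) - 1) * (Lam * b) := by
    have h := Finset.sum_le_card_nsmul (Finset.univ.erase k)
      (fun i => (U.col i ⬝ᵥ A *ᵥ U.col i) * e i) (Lam * b) fun i _ =>
        (mul_le_mul_of_nonneg_left (hle i) (hlam.le.trans (hdiag i).1)).trans
          (mul_le_mul_of_nonneg_right (hdiag i).2 hb)
    rwa [Finset.card_erase_of_mem (Finset.mem_univ k), Finset.card_univ, Fintype.card_fin,
      nsmul_eq_mul, Nat.cast_pred k.pos] at h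
  have hkey : (U.col k ⬝ᵥ A *ᵥ U.col k) * e k ≤ lam * t :=
    (mul_le_mul_of_nonneg_left hk (hlam.le.trans (hdiag k).1)).trans
      (mul_le_mul_of_nonpos_right (hdiag k).1 ht)
  change (A * M).trace ≤ _
  rw [htrace, ← Finset.sum_erase_add _ _ (Finset.mem_univ k)]
  exact add_le_add hrest hkey

/-- linear algebra facts used in the proof of the Lipschitz
estimate, from the matrix inequality of Jensen–Ishii's lemma. -/
theorem matrix_inequality_consequences
    (n : ℕ) (hn : 1 ≤ n) (lam Lam : ℝ) (hlam : 0 < lam) (hlamLam : lam ≤ Lam)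
    (X Y Z : Matrix (Fin n) (Fin n) ℝ)
    (hX : X.IsSymm) (hY : Y.IsSymm) (hZ : Z.IsSymm)
    (c : ℝ) (hc : 0 ≤ c)
    (hineq : ∀ ξ η : Fin n → ℝ,
      ξ ⬝ᵥ X.mulVec ξ - η ⬝ᵥ Y.mulVec η ≤
        (ξ - η) ⬝ᵥ Z.mulVec (ξ - η) + c * (ξ ⬝ᵥ ξ + η ⬝ᵥ η)) :
    (∀ hH : (X - Y).IsHermitian, ∀ i : Fin n, hH.eigenvalues i ≤ 2 * c) ∧
    (∀ η : Fin n → ℝ, η ⬝ᵥ η = 1 →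
      η ⬝ᵥ (X - Y).mulVec η ≤ 4 * (η ⬝ᵥ Z.mulVec η) + 2 * c) ∧
    (∀ η : Fin n → ℝ, η ⬝ᵥ η = 1 → 4 * (η ⬝ᵥ Z.mulVec η) + 2 * c ≤ 0 →
      pucciSup n lam Lam (X - Y) ≤
        2 * Lam * ((n : ℝ) - 1) * c + lam * (4 * (η ⬝ᵥ Z.mulVec η) + 2 * c)) := by
  have hform : ∀ η : Fin n → ℝ, η ⬝ᵥ (X - Y).mulVec η ≤ 2 * c * (η ⬝ᵥ η) := fun η => by
    have h := hineq η η
    rw [sub_self, zero_dotProduct] at h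
    rw [sub_mulVec, dotProduct_sub]
    linarith
  have heig : ∀ hH : (X - Y).IsHermitian, ∀ i : Fin n, hH.eigenvalues i ≤ 2 * c := by
    intro hH i
    obtain ⟨U, hU, -, hMU⟩ := hH.exists_orthogonal_diagonalization
    have hdiag : Uᵀ * (X - Y) * U = diagonal hH.eigenvalues := by
      calc Uᵀ * (X - Y) * U = (Uᵀ * U) * diagonal hH.eigenvalues * (Uᵀ * U) := by
            conv_lhs => rw [hMU]
            simp only [Matrix.mul_assoc]
        _ = diagonal hH.eigenvalues := by rw [hU, Matrix.one_mul, Matrix.mul_one]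
    have h := hform (U.col i)
    rwa [← transpose_mul_mul_apply_self, hdiag, diagonal_apply_eq,
      dotProduct_col_self_of_transpose_mul_self hU, mul_one] at h
  have hunit : ∀ η : Fin n → ℝ, η ⬝ᵥ η = 1 →
      η ⬝ᵥ (X - Y).mulVec η ≤ 4 * (η ⬝ᵥ Z.mulVec η) + 2 * c := by
    intro η hη
    have h := hineq η (-η)
    rw [sub_neg_eq_add] at h
    simp only [mulVec_neg, mulVec_add, dotProduct_neg, neg_dotProduct, neg_neg, dotProduct_add,
      add_dotProduct, hη] at h
    rw [sub_mulVec, dotProduct_sub]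
    linarith
  refine ⟨heig, hunit, fun η hη hneg => ?_⟩
  have hH : (X - Y).IsHermitian := by
    rw [IsHermitian, conjTranspose_eq_transpose_of_trivial]
    exact hX.sub hY
  obtain ⟨k, hk⟩ := hH.exists_eigenvalues_le hη
  have h := pucciSup_le_of_eigenvalues_le hlam hlamLam hH (mul_nonneg zero_le_two hc) hneg
    (heig hH) (hk.trans (hunit η hη))
  linarith

end
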